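/- (Stochastic Banach Principle, part i, commutative case.) Let $B$ be a Banach space, $(\Omega,\mu)$ a measure space, and $A_n : B \to L^0(\Omega,\mu)$ linear maps. Suppose there exists $C : \mathbb{R}_+ \to \mathbb{R}_+$ with $\lim_{\lambda\to\infty} C(\lambda) = 0$ such that $\sup_n \mu(\{|A_n(b)| > \lambda \|b\|\}) \leq C(\lambda)$ for every $b \in B$ and $\lambda > 0$. Then the set $\tilde{B} = \{b \in B : (A_n(b))_n$ converges in measure$\}$ is closed in $B$. -/

import Mathlib

open MeasureTheory Filter
open scoped ENNReal Topology

/-- A sequence of real functions that is Cauchy in measure converges in measure. No measurability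
is needed, since `μ` is used as an outer measure. -/
theorem exists_tendsto_measure_of_cauchy_in_measure
    {Ω : Type*} [MeasurableSpace Ω] (μ : Measure Ω) (g : ℕ → Ω → ℝ)
    (hg : ∀ ε > (0 : ℝ), ∀ δ > (0 : ℝ≥0∞), ∃ N, ∀ n ≥ N, ∀ m ≥ N,
      μ {ω | ε < |g n ω - g m ω|} ≤ δ) :
    ∃ f : Ω → ℝ, ∀ ε > (0 : ℝ), Tendsto (fun n => μ {ω | ε < |g n ω - f ω|}) atTop (𝓝 0) := by
  choose N hN using fun k : ℕ => hg ((2⁻¹ : ℝ) ^ k) (by positivity) ((2⁻¹ : ℝ≥0∞) ^ k)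
    (ENNReal.pow_pos (by simp) k)
  set s : ℕ → ℕ := fun k => partialSups N k
  have hNs : ∀ k, N k ≤ s k := fun k => le_partialSups N k
  have hs : ∀ k, s k ≤ s (k + 1) := fun k => (partialSups N).monotone k.le_succ
  have hlim : ∀ ω, ∃ a : ℝ, (∃ b, Tendsto (fun k => g (s k) ω) atTop (𝓝 b)) →
      Tendsto (fun k => g (s k) ω) atTop (𝓝 a) := by
    intro ω
    by_cases h : ∃ b, Tendsto (fun k => g (s k) ω) atTop (𝓝 b)
    · obtain ⟨b, hb⟩ := h
      exact ⟨b, fun _ => hb⟩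
    · exact ⟨0, fun h' => absurd h' h⟩
  choose f hf using hlim
  refine ⟨f, fun ε hε => ?_⟩
  set T : ℕ → Set Ω := fun K =>
    ⋃ j, {ω | (2⁻¹ : ℝ) ^ (K + j) < |g (s (K + j)) ω - g (s (K + j + 1)) ω|}
  have hT : ∀ K, μ (T K) ≤ 2 * (2⁻¹ : ℝ≥0∞) ^ K := by
    intro K
    calc μ (T K) ≤ ∑' j, (2⁻¹ : ℝ≥0∞) ^ (K + j) :=
          (measure_iUnion_le _).trans (ENNReal.tsum_le_tsum fun j =>
            hN (K + j) _ (hNs _) _ ((hNs _).trans (hs _)))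
      _ = 2 * (2⁻¹ : ℝ≥0∞) ^ K := by
          simp_rw [pow_add]
          rw [ENNReal.tsum_mul_left, ENNReal.tsum_geometric, ENNReal.one_sub_inv_two, inv_inv,
            mul_comm]
  have hfT : ∀ K, ∀ ω ∉ T K, |g (s K) ω - f ω| ≤ 2 * (2⁻¹ : ℝ) ^ K := by
    intro K ω hω
    have hstep : ∀ j, dist (g (s (K + j)) ω) (g (s (K + (j + 1))) ω)
        ≤ 2 * (2⁻¹ : ℝ) ^ K / 2 / 2 ^ j := by
      intro j
      have h : |g (s (K + j)) ω - g (s (K + j + 1)) ω| ≤ (2⁻¹ : ℝ) ^ (K + j) :=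
        not_lt.1 fun h => hω (Set.mem_iUnion.2 ⟨j, h⟩)
      rw [Real.dist_eq]
      refine h.trans_eq ?_
      rw [pow_add, inv_pow _ j]
      field_simp
    obtain ⟨b, hb⟩ := cauchySeq_tendsto_of_complete
      (cauchySeq_of_le_geometric_two (f := fun j => g (s (K + j)) ω) hstep)
    have hconv : Tendsto (fun k => g (s k) ω) atTop (𝓝 (f ω)) := by
      refine hf ω ⟨b, (tendsto_add_atTop_iff_nat K).1 ?_⟩
      simpa only [add_comm] using hb
    have hconv' : Tendsto (fun j => g (s (K + j)) ω) atTop (𝓝 (f ω)) := by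
      simpa only [add_comm] using (tendsto_add_atTop_iff_nat K).2 hconv
    simpa [Real.dist_eq] using
      dist_le_of_le_geometric_two_of_tendsto₀ (f := fun j => g (s (K + j)) ω) hstep hconv'
  have hεK : ∀ᶠ K : ℕ in atTop, 3 * (2⁻¹ : ℝ) ^ K < ε := by
    have h := (tendsto_pow_atTop_nhds_zero_of_lt_one (r := (2⁻¹ : ℝ)) (by norm_num)
      (by norm_num)).const_mul 3
    rw [mul_zero] at h
    exact h.eventually_lt_const hε
  rw [ENNReal.tendsto_nhds_zero]
  intro δ hδ
  have hδK : ∀ᶠ K : ℕ in atTop, 3 * (2⁻¹ : ℝ≥0∞) ^ K < δ := by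
    have h := ENNReal.Tendsto.const_mul (a := 3)
      (ENNReal.tendsto_pow_atTop_nhds_zero_of_lt_one (r := (2⁻¹ : ℝ≥0∞)) (by simp))
      (Or.inr (by simp))
    rw [mul_zero] at h
    exact h.eventually_lt_const hδ
  obtain ⟨K, hK, hK'⟩ := (hεK.and hδK).exists
  filter_upwards [eventually_ge_atTop (N K)] with n hn
  have hsub : {ω | ε < |g n ω - f ω|} ⊆
      T K ∪ {ω | (2⁻¹ : ℝ) ^ K < |g n ω - g (s K) ω|} := by
    intro ω hω
    by_contra hcon
    rw [Set.mem_union, not_or] at hcon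
    have h1 := hfT K ω hcon.1
    have h2 : |g n ω - g (s K) ω| ≤ (2⁻¹ : ℝ) ^ K := not_lt.1 hcon.2
    have h3 := abs_sub_le (g n ω) (g (s K) ω) (f ω)
    have h4 : ε < |g n ω - f ω| := hω
    linarith
  calc μ {ω | ε < |g n ω - f ω|}
      ≤ 2 * (2⁻¹ : ℝ≥0∞) ^ K + (2⁻¹ : ℝ≥0∞) ^ K :=
        (measure_mono hsub).trans ((measure_union_le _ _).trans
          (add_le_add (hT K) (hN K n hn _ (hNs K))))
    _ = 3 * (2⁻¹ : ℝ≥0∞) ^ K := by ring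
    _ ≤ δ := hK'.le

/-- (Stochastic Banach principle, part i, commutative case.)
Let `B` be a Banach space, `(Ω, μ)` a measure space and `Aₙ : B → L⁰(Ω, μ)` linear
maps.  If there is `C : ℝ₊ → ℝ≥0∞` with `C(λ) → 0` as `λ → ∞` such that
`sup_n μ{|Aₙ(b)| > λ‖b‖} ≤ C(λ)` for all `b` and `λ > 0`, then the set of `b` for
which `(Aₙ(b))ₙ` converges in measure is closed in `B`. -/
theorem stochastic_banach_principle_i
    {B : Type*} [NormedAddCommGroup B] [NormedSpace ℝ B] [CompleteSpace B]
    {Ω : Type*} [MeasurableSpace Ω] (μ : Measure Ω)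
    (A : ℕ → B →ₗ[ℝ] Ω → ℝ)
    (hmeas : ∀ n b, Measurable (A n b))
    (C : ℝ → ℝ≥0∞) (hC : Tendsto C atTop (𝓝 0))
    (hbound : ∀ (n : ℕ) (b : B) (lam : ℝ), 0 < lam →
      μ {ω | lam * ‖b‖ < |A n b ω|} ≤ C lam) :
    IsClosed {b : B | ∃ f : Ω → ℝ, ∀ ε > (0 : ℝ),
      Tendsto (fun n => μ {ω | ε < |A n b ω - f ω|}) atTop (𝓝 0)} := by
  refine isClosed_of_closure_subset fun b hb => ?_
  refine exists_tendsto_measure_of_cauchy_in_measure μ (fun n => A n b) fun ε hε δ hδ => ?_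
  have hε4 : 0 < ε / 4 := by positivity
  have hδ4 : 0 < δ / 4 := ENNReal.div_pos hδ.ne' (by simp)
  obtain ⟨lam, hlam, hlam0⟩ :=
    ((hC.eventually_lt_const hδ4).and (eventually_gt_atTop (0 : ℝ))).exists
  obtain ⟨c, ⟨f, hf⟩, hbc⟩ := Metric.mem_closure_iff.1 hb (ε / 4 / lam) (by positivity)
  have hnorm : lam * ‖b - c‖ ≤ ε / 4 := by
    rw [dist_eq_norm, lt_div_iff₀ hlam0] at hbc
    linarith
  obtain ⟨N, hN⟩ := eventually_atTop.1 ((hf _ hε4).eventually_lt_const hδ4)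
  refine ⟨N, fun n hn m hm => ?_⟩
  have hsub : {ω | ε < |A n b ω - A m b ω|} ⊆
      ({ω | lam * ‖b - c‖ < |A n (b - c) ω|} ∪ {ω | lam * ‖b - c‖ < |A m (b - c) ω|}) ∪
      ({ω | ε / 4 < |A n c ω - f ω|} ∪ {ω | ε / 4 < |A m c ω - f ω|}) := by
    intro ω hω
    by_contra hcon
    simp only [Set.mem_union, Set.mem_ofPred_eq, not_or, not_lt, map_sub, Pi.sub_apply] at hcon hω
    obtain ⟨⟨h1, h2⟩, h3, h4⟩ := hcon
    have h1' := abs_le.1 (h1.trans hnorm)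
    have h2' := abs_le.1 (h2.trans hnorm)
    have h3' := abs_le.1 h3
    have h4' := abs_le.1 h4
    refine hω.not_ge (abs_le.2 ⟨?_, ?_⟩) <;> linarith
  calc μ {ω | ε < |A n b ω - A m b ω|}
      ≤ (δ / 4 + δ / 4) + (δ / 4 + δ / 4) :=
        (measure_mono hsub).trans ((measure_union_le _ _).trans (add_le_add
          ((measure_union_le _ _).trans (add_le_add
            ((hbound n _ lam hlam0).trans hlam.le) ((hbound m _ lam hlam0).trans hlam.le)))
          ((measure_union_le _ _).trans (add_le_add (hN n hn).le (hN m hm).le))))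
    _ = 4 * (δ / 4) := by ring
    _ = δ := ENNReal.mul_div_cancel (by simp) (by simp)
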